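/- arXiv:2501.05672 — 2 statements merged into one kernel-verified Lean document; each statement's English description precedes it below -/
import Mathlib

section
/- Suppose Assumption A holds and η > 0. Let u₁ and u₂ be two utility functions (each twice differentiable with positive first and negative second derivative) such that −u₁″(x)/u₁′(x) ≥ −u₂″(x)/u₂′(x) for all x, and let (a₁*, d₁*) and (a₂*, d₂*) denote the corresponding optimal premium–deductible pairs (same X, S, η, w). Then a₁* ≥ a₂*, d₁* ≤ d₂*, and a₁* + d₁* ≤ a₂* + d₂*. -/
open MeasureTheory Set

noncomputable section

variable {Ω : Type*} [MeasurableSpace Ω]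
/-- Full-insurance premium `π_f = (1+η)𝔼[X]`. -/
def piFull (ℙ : Measure Ω) (η : ℝ) (X : Ω → ℝ) : ℝ := (1 + η) * ∫ ω, X ω ∂ℙ

/-- `g(a) = (1+η)·𝔼[X − (X − (S+a)⁺)⁺] − a`. -/
def gfun (ℙ : Measure Ω) (η : ℝ) (X S : Ω → ℝ) (a : ℝ) : ℝ :=
  (1 + η) * ∫ ω, (X ω - max (X ω - max (S ω + a) 0) 0) ∂ℙ - a

/-- `ā = inf {a ∈ [0, π_f] : g(a) ≤ 0}`. -/
def abar (ℙ : Measure Ω) (η : ℝ) (X S : Ω → ℝ) : ℝ :=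
  sInf {a | a ∈ Icc 0 (piFull ℙ η X) ∧ gfun ℙ η X S a ≤ 0}

/-- Distribution function of a random variable. -/
def distFn (ℙ : Measure Ω) (Y : Ω → ℝ) (t : ℝ) : ℝ := (ℙ {ω | Y ω ≤ t}).toReal

/-- The set of discontinuity points in `[0, M]` of the distribution function of `Y`. -/
def JumpSet (ℙ : Measure Ω) (Y : Ω → ℝ) (M : ℝ) : Set ℝ :=
  {x ∈ Icc (0 : ℝ) M | ¬ ContinuousAt (distFn ℙ Y) x}

/-- Assumption A: (1) `S ≥ 0` a.s.; (2) the distribution functions of `X` and of `X − S`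
have finitely many discontinuity points in `[0, M]`; (3) the distribution function of `X`
is strictly increasing on `[0, M]`; (4) `𝔼[(X − y)⁺ − (X − y − S)⁺] > 0` for `y ∈ [0, M)`. -/
def AssumpA (ℙ : Measure Ω) (X S : Ω → ℝ) (M : ℝ) : Prop :=
  (∀ᵐ ω ∂ℙ, 0 ≤ S ω) ∧
  (JumpSet ℙ X M).Finite ∧
  (JumpSet ℙ (fun ω => X ω - S ω) M).Finite ∧
  StrictMonoOn (distFn ℙ X) (Icc 0 M) ∧
  ∀ y ∈ Ico (0 : ℝ) M, 0 < ∫ ω, (max (X ω - y) 0 - max (X ω - y - S ω) 0) ∂ℙ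

/-- `g_a(y) = (1+η)·𝔼[(X − y)⁺ − (X − y − (S+a))⁺] − a`. -/
def gA (ℙ : Measure Ω) (η : ℝ) (X S : Ω → ℝ) (a y : ℝ) : ℝ :=
  (1 + η) * ∫ ω, (max (X ω - y) 0 - max (X ω - y - (S ω + a)) 0) ∂ℙ - a

/-- The threshold `u′(w − M)/𝔼[u′(w − X)] − 1` for the premium loading. -/
def thr (ℙ : Measure Ω) (X : Ω → ℝ) (u' : ℝ → ℝ) (w M : ℝ) : ℝ :=
  u' (w - M) / (∫ ω, u' (w - X ω) ∂ℙ) - 1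

/-- `dfun` is the deductible map `a ↦ d(a)`: for each `a ∈ [0, ā]`, `d(a)` is the
(unique) zero of `g_a` in `[0, M]`. -/
def DFun (ℙ : Measure Ω) (η : ℝ) (X S : Ω → ℝ) (M : ℝ) (dfun : ℝ → ℝ) : Prop :=
  ∀ a ∈ Icc 0 (abar ℙ η X S), dfun a ∈ Icc (0 : ℝ) M ∧ gA ℙ η X S a (dfun a) = 0

/-- `(astar, dstar)` is the optimal premium–deductible pair: `(0, M)` if
`η ≥ u′(w−M)/𝔼[u′(w−X)] − 1`; otherwise `astar ∈ (0, ā)` is the unique solution of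
`𝔼[u′(w − min(X, d(a)) − a)] = u′(w − d(a) − a)/(1+η)` and `dstar = d(astar)`. -/
def OptPair (ℙ : Measure Ω) (η : ℝ) (X S : Ω → ℝ) (u' : ℝ → ℝ) (w M : ℝ)
    (dfun : ℝ → ℝ) (astar dstar : ℝ) : Prop :=
  (thr ℙ X u' w M ≤ η → astar = 0 ∧ dstar = M) ∧
  (η < thr ℙ X u' w M →
    astar ∈ Ioo 0 (abar ℙ η X S) ∧
    (∫ ω, u' (w - min (X ω) (dfun astar) - astar) ∂ℙ)
      = u' (w - dfun astar - astar) / (1 + η) ∧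
    dstar = dfun astar)

/-- If the first utility has the larger Arrow–Pratt coefficient, then the ratio of its marginal
utility to that of the second is nonincreasing. -/
lemma mul_le_mul_of_arrowPratt {u₁' u₁'' u₂' u₂'' : ℝ → ℝ}
    (hu₁ : ∀ x, HasDerivAt u₁' (u₁'' x) x) (hpos₁ : ∀ x, 0 < u₁' x)
    (hu₂ : ∀ x, HasDerivAt u₂' (u₂'' x) x) (hpos₂ : ∀ x, 0 < u₂' x)
    (hAP : ∀ x, -u₂'' x / u₂' x ≤ -u₁'' x / u₁' x) {x y : ℝ} (hxy : x ≤ y) :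
    u₁' y * u₂' x ≤ u₂' y * u₁' x := by
  have hder : ∀ z, HasDerivAt (fun t => u₁' t / u₂' t)
      ((u₁'' z * u₂' z - u₁' z * u₂'' z) / u₂' z ^ 2) z :=
    fun z => (hu₁ z).fun_div (hu₂ z) (hpos₂ z).ne'
  have hanti : Antitone fun t => u₁' t / u₂' t := by
    refine antitone_of_deriv_nonpos (fun z => (hder z).differentiableAt) fun z => ?_
    rw [(hder z).deriv]
    have h := (div_le_div_iff₀ (hpos₂ z) (hpos₁ z)).1 (hAP z)
    exact div_nonpos_of_nonpos_of_nonneg (by linarith) (sq_nonneg _)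
  have h := (div_le_div_iff₀ (hpos₂ y) (hpos₂ x)).1 (hanti hxy)
  linarith

/-- A continuous function of an essentially bounded random variable is integrable. -/
lemma integrable_comp_of_ae_mem_Icc {ℙ : Measure Ω} [IsFiniteMeasure ℙ] {v : ℝ → ℝ}
    (hv : Continuous v) {Y : Ω → ℝ} (hY : Measurable Y) {lo hi : ℝ}
    (hmem : ∀ᵐ ω ∂ℙ, Y ω ∈ Icc lo hi) : Integrable (fun ω => v (Y ω)) ℙ := by
  obtain ⟨C, hC⟩ := isCompact_Icc.exists_bound_of_continuousOn (hv.continuousOn (s := Icc lo hi))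
  exact Integrable.of_bound (hv.measurable.comp hY).aestronglyMeasurable C
    (hmem.mono fun ω h => hC _ h)

/-- Marginal utility of the terminal wealth under a deductible is integrable. -/
lemma integrable_marginal_deductible {ℙ : Measure Ω} [IsFiniteMeasure ℙ] {v : ℝ → ℝ}
    (hv : Continuous v) {X : Ω → ℝ} (hX : Measurable X) (hX0 : ∀ ω, 0 ≤ X ω) {d : ℝ}
    (hd : 0 ≤ d) (w a : ℝ) : Integrable (fun ω => v (w - min (X ω) d - a)) ℙ := by
  refine integrable_comp_of_ae_mem_Icc hv (Y := fun ω => w - min (X ω) d - a)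
    (lo := w - d - a) (hi := w - a) (by fun_prop) (ae_of_all _ fun ω => ⟨?_, ?_⟩)
  · linarith [min_le_right (X ω) d]
  · linarith [le_min (hX0 ω) hd]

/-- A real random variable with nonzero real essential supremum (so not the default value of an
unbounded one) is almost surely at most its essential supremum. -/
lemma ae_le_essSup_of_ne_zero {ℙ : Measure Ω} [IsProbabilityMeasure ℙ] {X : Ω → ℝ}
    (h : essSup X ℙ ≠ 0) : ∀ᵐ ω ∂ℙ, X ω ≤ essSup X ℙ := by
  have hbdd : Filter.IsBoundedUnder (· ≤ ·) (ae ℙ) X := by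
    by_contra hcon
    refine h ?_
    rw [essSup, Filter.limsup_eq]
    have : {a : ℝ | ∀ᵐ ω ∂ℙ, X ω ≤ a} = ∅ := by
      ext a
      simp only [mem_ofPred_eq, mem_empty_iff_false, iff_false]
      exact fun ha => hcon ⟨a, by simpa [Filter.eventually_map] using ha⟩
    rw [this, Real.sInf_empty]
  exact ae_le_essSup hbdd

/-- The first-order condition forces `0 < ℙ(X < d)` and `(1 + η) ℙ(d < X) < 1`. -/
lemma measure_of_firstOrder {ℙ : Measure Ω} [IsProbabilityMeasure ℙ] {v : ℝ → ℝ}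
    (hv : Continuous v) (hanti : StrictAnti v) (hpos : ∀ x, 0 < v x) {X : Ω → ℝ}
    (hX : Measurable X) (hX0 : ∀ ω, 0 ≤ X ω) {η w a d : ℝ} (hη : 0 < η) (hd : 0 ≤ d)
    (hfoc : ∫ ω, v (w - min (X ω) d - a) ∂ℙ = v (w - d - a) / (1 + η)) :
    0 < ℙ {ω | X ω < d} ∧ (1 + η) * ℙ.real {ω | d < X ω} < 1 := by
  have hms : MeasurableSet {ω | d ≤ X ω} := measurableSet_le measurable_const hX
  set p := ℙ.real {ω | d ≤ X ω} with hp
  have hp1 : p ≤ 1 := measureReal_le_one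
  have hcompl : {ω | d ≤ X ω}ᶜ = {ω | X ω < d} := by ext; simp
  have hpc : ℙ.real {ω | X ω < d} = 1 - p := by
    rw [← hcompl, probReal_compl_eq_one_sub hms]
  have hlow : p * v (w - d - a) + (1 - p) * v (w - a) ≤ v (w - d - a) / (1 + η) := by
    rw [← hfoc, ← hpc, ← hcompl, hp, ← smul_eq_mul, ← smul_eq_mul,
      ← integral_indicator_const _ hms, ← integral_indicator_const _ hms.compl,
      ← integral_add ((integrable_const _).indicator hms)
        ((integrable_const _).indicator hms.compl)]
    refine integral_mono (((integrable_const _).indicator hms).add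
      ((integrable_const _).indicator hms.compl))
      (integrable_marginal_deductible hv hX hX0 hd w a) fun ω => ?_
    by_cases hω : d ≤ X ω
    · simp [indicator, hω]
    · simp only [indicator, mem_ofPred_eq, hω, if_false, mem_compl_iff, not_false_eq_true,
        if_true, zero_add]
      exact hanti.antitone (by linarith [le_min (hX0 ω) hd])
  have hD := hpos (w - d - a)
  have hc := hpos (w - a)
  rw [le_div_iff₀ (by linarith)] at hlow
  have hplt : p < 1 := by
    refine lt_of_le_of_ne hp1 fun h => ?_
    rw [h] at hlow
    nlinarith
  refine ⟨?_, ?_⟩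
  · have : 0 < ℙ.real {ω | X ω < d} := by linarith
    exact (ENNReal.toReal_pos_iff.1 this).1
  · have hle : ℙ.real {ω | d < X ω} ≤ p :=
      measureReal_mono fun ω (h : d < X ω) => h.le
    have h1 : 0 < (1 - p) * v (w - a) * (1 + η) := by
      have : 0 < 1 - p := by linarith
      positivity
    have h2 : (1 + η) * p < 1 := by
      by_contra! hcon
      nlinarith [mul_le_mul_of_nonneg_right hcon hD.le]
    nlinarith

/-- The integrand defining `gA` is integrable. -/
lemma integrable_layer {ℙ : Measure Ω} [IsFiniteMeasure ℙ] {X S : Ω → ℝ} (hX : Measurable X)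
    (hS : Measurable S) {M : ℝ} (hXM : ∀ᵐ ω ∂ℙ, X ω ≤ M)
    (hS0 : ∀ᵐ ω ∂ℙ, 0 ≤ S ω) {a : ℝ} (ha : 0 ≤ a) (y : ℝ) :
    Integrable (fun ω => max (X ω - y) 0 - max (X ω - y - (S ω + a)) 0) ℙ := by
  refine Integrable.of_bound (Measurable.aestronglyMeasurable (by fun_prop)) (|M| + |y|) ?_
  filter_upwards [hXM, hS0] with ω h1 h2
  have h3 : max (X ω - y) 0 ≤ |M| + |y| :=
    max_le (by linarith [le_abs_self M, neg_abs_le y]) (by positivity)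
  have h4 : max (X ω - y - (S ω + a)) 0 ≤ max (X ω - y) 0 := max_le_max (by linarith) le_rfl
  have h5 := le_max_right (X ω - y - (S ω + a)) 0
  rw [Real.norm_eq_abs, abs_le]
  constructor <;> linarith [abs_nonneg M, abs_nonneg y]

/-- If raising the premium from `a₂` to `a₁` raises the upper edge of the insured layer, then
the increase of the indemnity is at most `a₁ - a₂`, and it vanishes unless the loss exceeds
`d₁`. -/
lemma layer_sub_le {x s a₁ a₂ d₁ d₂ : ℝ} (hs : 0 ≤ s) (ha₂ : 0 ≤ a₂) (ha : a₂ < a₁)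
    (had : a₂ + d₂ < a₁ + d₁) :
    (max (x - d₁) 0 - max (x - d₁ - (s + a₁)) 0)
      - (max (x - d₂) 0 - max (x - d₂ - (s + a₂)) 0) ≤ if d₁ < x then a₁ - a₂ else 0 := by
  split_ifs with h <;>
    rcases max_cases (x - d₁) 0 with h1 | h1 <;>
    rcases max_cases (x - d₁ - (s + a₁)) 0 with h2 | h2 <;>
    rcases max_cases (x - d₂) 0 with h3 | h3 <;>
    rcases max_cases (x - d₂ - (s + a₂)) 0 with h4 | h4 <;>
    linarith

/-- Along zeros of `gA` with `(1 + η) ℙ(d < X) < 1`, premium plus deductible is nonincreasing in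
the premium. -/
lemma add_le_add_of_gA_eq_zero {ℙ : Measure Ω} [IsProbabilityMeasure ℙ] {X S : Ω → ℝ}
    (hX : Measurable X) (hS : Measurable S) {M : ℝ}
    (hXM : ∀ᵐ ω ∂ℙ, X ω ≤ M) (hS0 : ∀ᵐ ω ∂ℙ, 0 ≤ S ω) {η a₁ d₁ a₂ d₂ : ℝ} (hη : 0 < η)
    (ha₂ : 0 ≤ a₂) (ha : a₂ < a₁) (h₁ : gA ℙ η X S a₁ d₁ = 0) (h₂ : gA ℙ η X S a₂ d₂ = 0)
    (hq : (1 + η) * ℙ.real {ω | d₁ < X ω} < 1) : a₁ + d₁ ≤ a₂ + d₂ := by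
  by_contra! had
  have hms : MeasurableSet {ω | d₁ < X ω} := measurableSet_lt measurable_const hX
  have hi₁ := integrable_layer hX hS hXM hS0 (ha₂.trans ha.le) d₁
  have hi₂ := integrable_layer hX hS hXM hS0 ha₂ d₂
  have hle := integral_mono_ae (hi₁.sub hi₂) ((integrable_const (a₁ - a₂)).indicator hms)
    (hS0.mono fun ω hω => by
      simpa [indicator] using layer_sub_le (x := X ω) hω ha₂ ha had)
  simp only [Pi.sub_apply] at hle
  rw [integral_sub hi₁ hi₂, integral_indicator_const _ hms, smul_eq_mul] at hle
  unfold gA at h₁ h₂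
  have := mul_lt_mul_of_pos_right hq (sub_pos.2 ha)
  nlinarith [mul_le_mul_of_nonneg_left hle (by linarith : (0 : ℝ) ≤ 1 + η)]

/-- The first-order conditions order the premiums by risk aversion, provided that a larger premium
comes with a smaller sum of premium and deductible. -/
lemma premium_le_of_firstOrder {ℙ : Measure Ω} [IsProbabilityMeasure ℙ] {v₁ v₂ : ℝ → ℝ}
    (hv₁ : Continuous v₁) (hanti₁ : StrictAnti v₁) (hpos₁ : ∀ x, 0 < v₁ x)
    (hv₂ : Continuous v₂) (hpos₂ : ∀ x, 0 < v₂ x)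
    (hratio : ∀ x y, x ≤ y → v₁ y * v₂ x ≤ v₂ y * v₁ x) {X : Ω → ℝ} (hX : Measurable X)
    (hX0 : ∀ ω, 0 ≤ X ω) {η w a₁ d₁ a₂ d₂ : ℝ} (hη : 0 < η) (hd₁ : 0 ≤ d₁) (hd₂ : 0 ≤ d₂)
    (hfoc₁ : ∫ ω, v₁ (w - min (X ω) d₁ - a₁) ∂ℙ = v₁ (w - d₁ - a₁) / (1 + η))
    (hfoc₂ : ∫ ω, v₂ (w - min (X ω) d₂ - a₂) ∂ℙ = v₂ (w - d₂ - a₂) / (1 + η))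
    (hsum : a₁ < a₂ → a₂ + d₂ ≤ a₁ + d₁) : a₂ ≤ a₁ := by
  by_contra! ha
  have he := hsum ha
  have hi₁ := integrable_marginal_deductible (ℙ := ℙ) hv₁ hX hX0 hd₁ w a₁
  have hi₁₂ := integrable_marginal_deductible (ℙ := ℙ) hv₁ hX hX0 hd₂ w a₂
  have hi₂ := integrable_marginal_deductible (ℙ := ℙ) hv₂ hX hX0 hd₂ w a₂
  have hPos := (measure_of_firstOrder hv₁ hanti₁ hpos₁ hX hX0 hη hd₁ hfoc₁).1
  set E₁ := v₁ (w - d₁ - a₁) with hE₁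
  set E₁₂ := v₁ (w - d₂ - a₂) with hE₁₂
  set E₂ := v₂ (w - d₂ - a₂) with hE₂
  have hE₁pos : 0 < E₁ := hpos₁ _
  have hE₁₂pos : 0 < E₁₂ := hpos₁ _
  have hE₂pos : 0 < E₂ := hpos₂ _
  have hEle : E₁₂ ≤ E₁ := hanti₁.antitone (by linarith)
  have hcmp : (∫ ω, v₁ (w - min (X ω) d₂ - a₂) ∂ℙ) * E₂ ≤ E₂ / (1 + η) * E₁₂ := by
    rw [← hfoc₂, ← integral_mul_const, ← integral_mul_const]
    exact integral_mono (hi₁₂.mul_const _) (hi₂.mul_const _) fun ω =>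
      hratio _ _ (by linarith [min_le_right (X ω) d₂])
  have hcmp' : ∫ ω, v₁ (w - min (X ω) d₂ - a₂) ∂ℙ ≤ E₁₂ / (1 + η) := by
    refine le_of_mul_le_mul_right (hcmp.trans_eq ?_) hE₂pos
    ring
  have hlt : ∀ ω, X ω < d₁ →
      v₁ (w - min (X ω) d₁ - a₁) * E₁₂ < v₁ (w - min (X ω) d₂ - a₂) * E₁ := by
    intro ω hω
    rw [min_eq_left hω.le]
    rcases le_total (X ω) d₂ with h | h
    · rw [min_eq_left h]
      exact mul_lt_mul (hanti₁ (by linarith)) hEle hE₁₂pos (hpos₁ _).le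
    · rw [min_eq_right h, ← hE₁₂, mul_comm]
      exact mul_lt_mul_of_pos_left (hanti₁ (by linarith)) hE₁₂pos
  have hge : ∀ ω, d₁ ≤ X ω →
      v₁ (w - min (X ω) d₁ - a₁) * E₁₂ = v₁ (w - min (X ω) d₂ - a₂) * E₁ := by
    intro ω hω
    rw [min_eq_right hω, min_eq_right (show d₂ ≤ X ω by linarith), mul_comm]
  have hintegral : 0 < ∫ ω, (v₁ (w - min (X ω) d₂ - a₂) * E₁
      - v₁ (w - min (X ω) d₁ - a₁) * E₁₂) ∂ℙ := by
    refine (integral_pos_iff_support_of_nonneg ?_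
      ((hi₁₂.mul_const E₁).sub (hi₁.mul_const E₁₂))).2 ?_
    · intro ω
      rcases lt_or_ge (X ω) d₁ with h | h
      · exact (sub_pos.2 (hlt ω h)).le
      · exact (sub_eq_zero.2 (hge ω h).symm).ge
    · exact hPos.trans_le (measure_mono fun ω hω => (sub_pos.2 (hlt ω hω)).ne')
  rw [integral_sub (hi₁₂.mul_const _) (hi₁.mul_const _), integral_mul_const, integral_mul_const,
    hfoc₁] at hintegral
  have h := mul_le_mul_of_nonneg_right hcmp' hE₁pos.le
  have : E₁₂ / (1 + η) * E₁ = E₁ / (1 + η) * E₁₂ := by ring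
  linarith

/-- The threshold on the premium loading is monotone in risk aversion. -/
lemma thr_le_thr {ℙ : Measure Ω} [IsProbabilityMeasure ℙ] {v₁ v₂ : ℝ → ℝ}
    (hv₁ : Continuous v₁) (hpos₁ : ∀ x, 0 < v₁ x) (hv₂ : Continuous v₂) (hpos₂ : ∀ x, 0 < v₂ x)
    (hratio : ∀ x y, x ≤ y → v₁ y * v₂ x ≤ v₂ y * v₁ x) {X : Ω → ℝ} (hX : Measurable X)
    (hX0 : ∀ ω, 0 ≤ X ω) {M : ℝ} (hXM : ∀ᵐ ω ∂ℙ, X ω ≤ M) (w : ℝ) :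
    thr ℙ X v₂ w M ≤ thr ℙ X v₁ w M := by
  have hmem : ∀ᵐ ω ∂ℙ, w - X ω ∈ Icc (w - M) w :=
    hXM.mono fun ω h => ⟨by linarith, by linarith [hX0 ω]⟩
  have hY : Measurable fun ω => w - X ω := by fun_prop
  have hi₁ := integrable_comp_of_ae_mem_Icc hv₁ hY hmem
  have hi₂ := integrable_comp_of_ae_mem_Icc hv₂ hY hmem
  have hint_pos : ∀ {v : ℝ → ℝ}, (∀ x, 0 < v x) → Integrable (fun ω => v (w - X ω)) ℙ →
      0 < ∫ ω, v (w - X ω) ∂ℙ := by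
    intro v hv hi
    rw [integral_pos_iff_support_of_nonneg (fun ω => (hv _).le) hi,
      show Function.support (fun ω => v (w - X ω)) = univ from
        eq_univ_of_forall fun ω => (hv _).ne']
    simp
  unfold thr
  refine sub_le_sub_right ?_ 1
  rw [div_le_div_iff₀ (hint_pos hpos₂ hi₂) (hint_pos hpos₁ hi₁), mul_comm, mul_comm (v₁ _),
    ← integral_mul_const, ← integral_mul_const]
  refine integral_mono_ae (hi₁.mul_const _) (hi₂.mul_const _) ?_
  filter_upwards [hmem] with ω hω using hratio _ _ hω.1

/-- comparative statics in risk aversion. If buyer 1 is (Arrow–Pratt) more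
risk averse than buyer 2, then `a₁* ≥ a₂*`, `d₁* ≤ d₂*`, and `a₁* + d₁* ≤ a₂* + d₂*`. -/
theorem stmt14
    (ℙ : Measure Ω) [IsProbabilityMeasure ℙ]
    (X S : Ω → ℝ) (hXm : Measurable X) (hSm : Measurable S)
    (hX0 : ∀ ω, 0 ≤ X ω) (M : ℝ) (hM : essSup X ℙ = M) (hM0 : 0 < M)
    (η : ℝ) (hη : 0 < η) (w : ℝ)
    (hA : AssumpA ℙ X S M)
    (u₁ u₁' u₁'' u₂ u₂' u₂'' : ℝ → ℝ)
    (hu₁' : ∀ x, HasDerivAt u₁ (u₁' x) x) (hu₁'' : ∀ x, HasDerivAt u₁' (u₁'' x) x)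
    (hu₁pos : ∀ x, 0 < u₁' x) (hu₁neg : ∀ x, u₁'' x < 0)
    (hu₂' : ∀ x, HasDerivAt u₂ (u₂' x) x) (hu₂'' : ∀ x, HasDerivAt u₂' (u₂'' x) x)
    (hu₂pos : ∀ x, 0 < u₂' x) (hu₂neg : ∀ x, u₂'' x < 0)
    (hAP : ∀ x, -u₂'' x / u₂' x ≤ -u₁'' x / u₁' x)
    (dfun : ℝ → ℝ) (hd : DFun ℙ η X S M dfun)
    (a₁ d₁ a₂ d₂ : ℝ)
    (hp₁ : OptPair ℙ η X S u₁' w M dfun a₁ d₁)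
    (hp₂ : OptPair ℙ η X S u₂' w M dfun a₂ d₂) :
    a₂ ≤ a₁ ∧ d₁ ≤ d₂ ∧ a₁ + d₁ ≤ a₂ + d₂ := by
  have hXM : ∀ᵐ ω ∂ℙ, X ω ≤ M := hM ▸ ae_le_essSup_of_ne_zero (hM ▸ hM0.ne')
  obtain ⟨hS0, -⟩ := hA
  have hc₁ : Continuous u₁' := continuous_iff_continuousAt.2 fun x => (hu₁'' x).continuousAt
  have hc₂ : Continuous u₂' := continuous_iff_continuousAt.2 fun x => (hu₂'' x).continuousAt
  have hanti₁ : StrictAnti u₁' :=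
    strictAnti_of_deriv_neg fun x => by rw [(hu₁'' x).deriv]; exact hu₁neg x
  have hanti₂ : StrictAnti u₂' :=
    strictAnti_of_deriv_neg fun x => by rw [(hu₂'' x).deriv]; exact hu₂neg x
  have hratio : ∀ x y, x ≤ y → u₁' y * u₂' x ≤ u₂' y * u₁' x := fun x y hxy =>
    mul_le_mul_of_arrowPratt hu₁'' hu₁pos hu₂'' hu₂pos hAP hxy
  have hthr := thr_le_thr hc₁ hu₁pos hc₂ hu₂pos hratio hXm hX0 hXM w
  rcases le_or_gt (thr ℙ X u₁' w M) η with ht₁ | ht₁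
  · obtain ⟨rfl, rfl⟩ := hp₁.1 ht₁
    obtain ⟨rfl, rfl⟩ := hp₂.1 (hthr.trans ht₁)
    simp
  obtain ⟨ha₁, hfoc₁, rfl⟩ := hp₁.2 ht₁
  obtain ⟨⟨hd₁, -⟩, hg₁⟩ := hd a₁ (Ioo_subset_Icc_self ha₁)
  have hq₁ := (measure_of_firstOrder hc₁ hanti₁ hu₁pos hXm hX0 hη hd₁ hfoc₁).2
  rcases le_or_gt (thr ℙ X u₂' w M) η with ht₂ | ht₂
  · obtain ⟨rfl, rfl⟩ := hp₂.1 ht₂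
    have hgM : gA ℙ η X S 0 d₂ = 0 := by
      have : ∀ᵐ ω ∂ℙ, max (X ω - d₂) 0 - max (X ω - d₂ - (S ω + 0)) 0 = 0 := by
        filter_upwards [hXM, hS0] with ω h1 h2
        rw [max_eq_right (by linarith), max_eq_right (by linarith), sub_zero]
      rw [gA, integral_eq_zero_of_ae this, mul_zero, sub_zero]
    have hsum := add_le_add_of_gA_eq_zero hXm hSm hXM hS0 hη le_rfl ha₁.1 hg₁ hgM hq₁
    exact ⟨ha₁.1.le, by linarith [ha₁.1], hsum⟩
  obtain ⟨ha₂, hfoc₂, rfl⟩ := hp₂.2 ht₂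
  obtain ⟨⟨hd₂, -⟩, hg₂⟩ := hd a₂ (Ioo_subset_Icc_self ha₂)
  have hq₂ := (measure_of_firstOrder hc₂ hanti₂ hu₂pos hXm hX0 hη hd₂ hfoc₂).2
  have ha : a₂ ≤ a₁ :=
    premium_le_of_firstOrder hc₁ hanti₁ hu₁pos hc₂ hu₂pos hratio hXm hX0 hη hd₁ hd₂ hfoc₁ hfoc₂
      fun h => add_le_add_of_gA_eq_zero hXm hSm hXM hS0 hη ha₁.1.le h hg₂ hg₁ hq₂
  rcases ha.eq_or_lt with rfl | hlt
  · simp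
  · have hsum := add_le_add_of_gA_eq_zero hXm hSm hXM hS0 hη ha₂.1.le hlt hg₁ hg₂ hq₁
    exact ⟨ha, by linarith, hsum⟩
end
end

section
/- For every I ∈ 𝓐_IC there exist a real number a and constants 0 ≤ l₁ ≤ l₂ ≤ ⋯ ≤ l_N ≤ M such that the contract Î defined by Î(x) = (x − l₁)⁺ − (x − l₁ − (a+s₁)⁺)⁺ + Σ_{i=2}^{N} [(x − l_i − (a+s_{i−1})⁺)⁺ − (x − l_i − (a+s_i)⁺)⁺] belongs to 𝓐_IC, has premium π(Î) = a, and satisfies 𝔼[u(W_S(Î))] ≥ 𝔼[u(W_S(I))]. Moreover, if s_N > 0 then a ∈ [0, ā_N], where ā_N is the unique zero on [0, π_f] of a ↦ (1+η)𝔼[X − (X − (s_N+a))⁺] − a and π_f = (1+η)𝔼[X]. -/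
open MeasureTheory Set

noncomputable section

variable {Ω : Type*} [MeasurableSpace Ω]

/-- Expected-value premium of a loss-dependent indemnity `I = I(x)`. -/
def piS (ℙ : Measure Ω) (η : ℝ) (X : Ω → ℝ) (I : ℝ → ℝ) : ℝ :=
  (1 + η) * ∫ ω, I (X ω) ∂ℙ

/-- Buyer's terminal wealth `W_S(I) = w − X + 𝕀_S(X; I) − π(I)` where
`𝕀_S(X; I) = I(X)·1_{I(X) ≤ (S+π(I))⁺} + τ·(S+π(I))⁺·1_{I(X) > (S+π(I))⁺}`. -/
def wealthS (ℙ : Measure Ω) (η τ w : ℝ) (X S : Ω → ℝ) (I : ℝ → ℝ) (ω : Ω) : ℝ :=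
  w - X ω +
    (if I (X ω) ≤ max (S ω + piS ℙ η X I) 0 then I (X ω)
     else τ * max (S ω + piS ℙ η X I) 0) - piS ℙ η X I

/-- Buyer's expected utility `𝔼[u(W_S(I))]`. -/
def EUS (ℙ : Measure Ω) (η τ w : ℝ) (X S : Ω → ℝ) (u : ℝ → ℝ) (I : ℝ → ℝ) : ℝ :=
  ∫ ω, u (wealthS ℙ η τ w X S I ω) ∂ℙ

/-- The admissible set `𝓐_IC`: measurable, `I(0) = 0`, and
`0 ≤ I(x) − I(x′) ≤ x − x′` for all `0 ≤ x′ ≤ x ≤ M`. -/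
def AIC (M : ℝ) (I : ℝ → ℝ) : Prop :=
  Measurable I ∧ I 0 = 0 ∧
    ∀ x' x : ℝ, 0 ≤ x' → x' ≤ x → x ≤ M → 0 ≤ I x - I x' ∧ I x - I x' ≤ x - x'

/-- `g_N(a) = (1+η)·𝔼[X − (X − (s+a))⁺] − a`. -/
def gN (ℙ : Measure Ω) (η : ℝ) (X : Ω → ℝ) (s a : ℝ) : ℝ :=
  (1 + η) * ∫ ω, (X ω - max (X ω - (s + a)) 0) ∂ℙ - a

/-- The multi-layer contract
`Î(x) = (x − l₁)⁺ − (x − l₁ − (a+s₁)⁺)⁺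
      + Σ_{i=2}^{N} [(x − l_i − (a+s_{i−1})⁺)⁺ − (x − l_i − (a+s_i)⁺)⁺]`. -/
def layered (N : ℕ) (a : ℝ) (s l : ℕ → ℝ) (x : ℝ) : ℝ :=
  max (x - l 1) 0 - max (x - l 1 - max (a + s 1) 0) 0 +
    ∑ i ∈ Finset.Icc 2 N,
      (max (x - l i - max (a + s (i - 1)) 0) 0 - max (x - l i - max (a + s i) 0) 0)

/-! ### Pointwise comparison of payoffs -/

/-- The indemnity actually paid when `y` is promised and the insurer's assets are `c`. -/
def payout (τ c y : ℝ) : ℝ := if y ≤ c then y else τ * c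

lemma wealthS_eq (ℙ : Measure Ω) (η τ w : ℝ) (X S : Ω → ℝ) (I : ℝ → ℝ) (ω : Ω) :
    wealthS ℙ η τ w X S I ω =
      w - X ω + payout τ (max (S ω + piS ℙ η X I) 0) (I (X ω)) - piS ℙ η X I := rfl

lemma payout_mem_Icc {τ c y : ℝ} (hτ : τ ∈ Icc (0 : ℝ) 1) (hc : 0 ≤ c) (hy : 0 ≤ y) :
    payout τ c y ∈ Icc 0 y := by
  obtain ⟨h0, h1⟩ := hτ
  unfold payout
  split_ifs with h
  · exact ⟨hy, le_rfl⟩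
  · exact ⟨by positivity, by nlinarith⟩

lemma mul_le_payout {τ c y : ℝ} (hτ : τ ∈ Icc (0 : ℝ) 1) (hc : 0 ≤ c) (hy : c ≤ y) :
    τ * c ≤ payout τ c y := by
  obtain ⟨h0, h1⟩ := hτ
  unfold payout
  split_ifs with h
  · nlinarith
  · exact le_rfl

/-- Lowering the premium from `p` to `a` and the indemnity by the same amount, after capping it at
the largest asset level, does not decrease the net payoff. -/
lemma payout_sub_le_payout_shift {τ t σ a p y : ℝ} (hτ : τ ∈ Icc (0 : ℝ) 1) (ht : t ≤ σ)
    (hap : a ≤ p) :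
    payout τ (max (t + p) 0) y - p ≤
      payout τ (max (t + a) 0) (max (min y (max (σ + p) 0) - (p - a)) 0) - a := by
  by_cases h : y ≤ max (t + p) 0
  · have hσ : y ≤ max (σ + p) 0 := h.trans (max_le_max (by linarith) le_rfl)
    have h2 : max (y - (p - a)) 0 ≤ max (t + a) 0 := by
      rcases le_total (t + p) 0 with h0 | h0
      · rw [max_eq_right h0] at h
        exact max_le ((by linarith : y - (p - a) ≤ 0).trans (le_max_right _ _)) (le_max_right _ _)
      · rw [max_eq_left h0] at h
        exact max_le_max (by linarith) le_rfl
    rw [min_eq_left hσ, payout, if_pos h, payout, if_pos h2]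
    linarith [le_max_left (y - (p - a)) 0]
  · push Not at h
    have h3 : max (t + a) 0 ≤ max (min y (max (σ + p) 0) - (p - a)) 0 := by
      refine max_le ?_ (le_max_right _ _)
      have h1 : t + p ≤ y := (le_max_left _ _).trans h.le
      have h2 : t + p ≤ max (σ + p) 0 := le_trans (by linarith) (le_max_left _ _)
      have := le_min h1 h2
      exact le_trans (by linarith) (le_max_left _ _)
    have h4 := mul_le_payout hτ (le_max_right (t + a) 0) h3
    have h5 : max (t + p) 0 - max (t + a) 0 ≤ p - a := by
      rcases max_cases (t + p) 0 with h | h <;> rcases max_cases (t + a) 0 with h' | h' <;> linarith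
    have h6 : max (t + a) 0 ≤ max (t + p) 0 := max_le_max (by linarith) le_rfl
    rw [payout, if_neg h.not_ge]
    obtain ⟨h0, h1⟩ := hτ
    nlinarith

/-! ### Admissible contracts -/

lemma AIC.nonneg {M : ℝ} {I : ℝ → ℝ} (hI : AIC M I) {x : ℝ} (h0 : 0 ≤ x) (hx : x ≤ M) :
    0 ≤ I x := by
  have := (hI.2.2 0 x le_rfl h0 hx).1
  rw [hI.2.1] at this
  linarith

lemma AIC.le_self {M : ℝ} {I : ℝ → ℝ} (hI : AIC M I) {x : ℝ} (h0 : 0 ≤ x) (hx : x ≤ M) :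
    I x ≤ x := by
  have := (hI.2.2 0 x le_rfl h0 hx).2
  rw [hI.2.1] at this
  linarith

lemma AIC.capShift {M : ℝ} {I : ℝ → ℝ} (hI : AIC M I) {C δ : ℝ} (hC : 0 ≤ C) (hδ : 0 ≤ δ) :
    AIC M (fun x => max (min (I x) C - δ) 0) := by
  refine ⟨((hI.1.min measurable_const).sub_const _).max measurable_const, ?_, ?_⟩
  · simp only [hI.2.1, min_eq_left hC]
    exact max_eq_right (by linarith)
  · intro x' x h0 hx hM
    obtain ⟨h1, h2⟩ := hI.2.2 x' x h0 hx hM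
    constructor
    · have : max (min (I x') C - δ) 0 ≤ max (min (I x) C - δ) 0 := by
        gcongr
        linarith
      linarith
    · have : max (min (I x) C - δ) 0 ≤ max (min (I x') C - δ) 0 + (x - x') := by
        refine max_le ?_ (by linarith [le_max_right (min (I x') C - δ) 0])
        have : min (I x) C ≤ min (I x') C + (x - x') := by
          rw [← min_add_add_right]
          exact min_le_min (by linarith) (by linarith)
        linarith [le_max_left (min (I x') C - δ) 0]
      linarith

/-- The retained losses `x - I x` over the level sets `{I ≤ c i}` are separated by a sequence. -/
lemma AIC.exists_separating {M : ℝ} (hM : 0 ≤ M) {I : ℝ → ℝ} (hI : AIC M I) {c : ℕ → ℝ}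
    (hc : Monotone c) (hc0 : c 0 = 0) :
    ∃ d : ℕ → ℝ, Monotone d ∧ (∀ i, 0 ≤ d i ∧ d i ≤ M) ∧
      (∀ i x, 0 ≤ x → x ≤ M → I x ≤ c i → x - I x ≤ d i) ∧
      (∀ i x, 0 ≤ x → x ≤ M → c i < I x → d i ≤ x - I x) := by
  set A : ℕ → Set ℝ := fun i => (fun x => x - I x) '' {x | 0 ≤ x ∧ x ≤ M ∧ I x ≤ c i} with hA
  have hmem : ∀ i, (0 : ℝ) ∈ A i := fun i =>
    ⟨0, ⟨le_rfl, hM, by rw [hI.2.1, ← hc0]; exact hc (Nat.zero_le i)⟩, by simp [hI.2.1]⟩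
  have hbd : ∀ i, ∀ y ∈ A i, y ≤ M := by
    rintro i _ ⟨x, ⟨h0, hx, -⟩, rfl⟩
    have := hI.nonneg h0 hx
    show x - I x ≤ M
    linarith
  refine ⟨fun i => sSup (A i), ?_, fun i => ⟨?_, ?_⟩, ?_, ?_⟩
  · intro i j hij
    refine csSup_le_csSup ⟨M, hbd j⟩ ⟨0, hmem i⟩ (image_mono ?_)
    exact fun x hx => ⟨hx.1, hx.2.1, hx.2.2.trans (hc hij)⟩
  · exact le_csSup ⟨M, hbd i⟩ (hmem i)
  · exact csSup_le ⟨0, hmem i⟩ (hbd i)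
  · intro i x h0 hx h
    exact le_csSup ⟨M, hbd i⟩ ⟨x, ⟨h0, hx, h⟩, rfl⟩
  · intro i x h0 hx h
    refine csSup_le ⟨0, hmem i⟩ ?_
    rintro _ ⟨z, ⟨hz0, hz, hzc⟩, rfl⟩
    have hzx : z ≤ x := by
      by_contra! hlt
      have := (hI.2.2 x z h0 hlt.le hz).1
      linarith
    have := (hI.2.2 z x hz0 hzx hx).2
    show z - I z ≤ x - I x
    linarith

/-! ### Towers of layers -/

/-- The sum of the first `n` layers; layer `i` pays the part of `x - l i` between `c i` and
`c (i + 1)`. -/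
def tower (c l : ℕ → ℝ) (n : ℕ) (x : ℝ) : ℝ :=
  ∑ i ∈ Finset.range n, (max (x - l i - c i) 0 - max (x - l i - c (i + 1)) 0)

lemma tower_succ (c l : ℕ → ℝ) (n : ℕ) (x : ℝ) :
    tower c l (n + 1) x =
      tower c l n x + (max (x - l n - c n) 0 - max (x - l n - c (n + 1)) 0) :=
  Finset.sum_range_succ _ _

lemma layered_eq_tower {N : ℕ} (hN : 1 ≤ N) {a : ℝ} {s l c : ℕ → ℝ} (hc0 : c 0 = 0)
    (hc : ∀ i, 1 ≤ i → i ≤ N → c i = max (a + s i) 0) :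
    layered N a s l = tower c (fun i => l (i + 1)) N := by
  funext x
  induction N, hN using Nat.le_induction with
  | base => simp [layered, tower, hc0, hc 1 le_rfl le_rfl]
  | succ n hn ih =>
    have h := ih (fun i h1 h2 => hc i h1 (by omega))
    unfold layered at h ⊢
    rw [tower_succ, ← h, Finset.sum_Icc_succ_top (by omega), hc n hn (by omega),
      hc (n + 1) (by omega) le_rfl, Nat.add_sub_cancel, add_assoc]

section Tower

variable {c l : ℕ → ℝ}

lemma measurable_tower (n : ℕ) : Measurable (tower c l n) := by
  unfold tower
  fun_prop

lemma tower_eq_of_le (hc : Monotone c) (hc0 : c 0 = 0) {n : ℕ} {x : ℝ}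
    (h : ∀ i < n, l i + c (i + 1) ≤ x) : tower c l n x = c n := by
  induction n with
  | zero => simp [tower, hc0]
  | succ n ih =>
    have h1 := h n (by omega)
    have h2 := hc (Nat.le_succ n)
    simp only [Nat.succ_eq_add_one] at h2
    rw [tower_succ, ih (fun i hi => h i (by omega)), max_eq_left (by linarith),
      max_eq_left (by linarith)]
    ring

lemma tower_eq_tower_of_le (hc : Monotone c) {k n : ℕ} (hkn : k ≤ n) {x : ℝ}
    (h : ∀ i, k ≤ i → x ≤ l i + c i) : tower c l n x = tower c l k x := by
  induction n, hkn using Nat.le_induction with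
  | base => rfl
  | succ n hn ih =>
    have h1 := h n hn
    have h2 := hc (Nat.le_succ n)
    simp only [Nat.succ_eq_add_one] at h2
    rw [tower_succ, ih, max_eq_right (by linarith), max_eq_right (by linarith)]
    ring

lemma tower_le (hc : Monotone c) (hc0 : c 0 = 0) (n : ℕ) (x : ℝ) : tower c l n x ≤ c n := by
  induction n with
  | zero => simp [tower, hc0]
  | succ n ih =>
    have h2 := hc (Nat.le_succ n)
    simp only [Nat.succ_eq_add_one] at h2
    rw [tower_succ]
    have : max (x - l n - c n) 0 ≤ max (x - l n - c (n + 1)) 0 + (c (n + 1) - c n) :=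
      max_le (by linarith [le_max_left (x - l n - c (n + 1)) 0])
        (by linarith [le_max_right (x - l n - c (n + 1)) 0])
    linarith

lemma tower_succ_eq_max (hc : Monotone c) (hc0 : c 0 = 0) {n : ℕ} {x : ℝ}
    (h : min (x - l n) (c n) ≤ tower c l n x) :
    tower c l (n + 1) x = max (tower c l n x) (min (x - l n) (c (n + 1))) := by
  have h1 := tower_le (l := l) hc hc0 n x
  have h2 := hc (Nat.le_succ n)
  simp only [Nat.succ_eq_add_one] at h2
  rw [tower_succ]
  rcases le_total (x - l n) (c n) with h3 | h3
  · rw [min_eq_left h3] at h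
    rw [max_eq_right (by linarith : x - l n - c n ≤ 0),
      max_eq_right (by linarith : x - l n - c (n + 1) ≤ 0), min_eq_left (h3.trans h2),
      max_eq_left h]
    ring
  · rw [min_eq_right h3] at h
    rw [le_antisymm h1 h, max_eq_left (by linarith : 0 ≤ x - l n - c n), max_eq_right (le_min h3 h2)]
    rcases le_total (x - l n) (c (n + 1)) with h4 | h4
    · rw [min_eq_left h4, max_eq_right (by linarith)]; ring
    · rw [min_eq_right h4, max_eq_left (by linarith)]; ring

lemma min_le_tower (hc : Monotone c) (hc0 : c 0 = 0) (hl : Monotone l) (n : ℕ) (x : ℝ) :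
    min (x - l n) (c n) ≤ tower c l n x := by
  induction n with
  | zero => simp [tower, hc0]
  | succ n ih =>
    rw [tower_succ_eq_max hc hc0 ih]
    have h2 := hl (Nat.le_succ n)
    simp only [Nat.succ_eq_add_one] at h2
    exact (min_le_min (by linarith) le_rfl).trans (le_max_right _ _)

lemma tower_sub_mem_Icc (hc : Monotone c) (hc0 : c 0 = 0) (hl : Monotone l) (n : ℕ) {x x' : ℝ}
    (hx : x' ≤ x) : tower c l n x' ≤ tower c l n x ∧
      tower c l n x ≤ tower c l n x' + (x - x') := by
  induction n with
  | zero => simpa [tower] using hx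
  | succ n ih =>
    rw [tower_succ_eq_max hc hc0 (min_le_tower hc hc0 hl n x),
      tower_succ_eq_max hc hc0 (min_le_tower hc hc0 hl n x')]
    refine ⟨max_le_max ih.1 (min_le_min (by linarith) le_rfl), ?_⟩
    rw [← max_add_add_right, ← min_add_add_right]
    exact max_le_max ih.2 (min_le_min (by linarith) (by linarith))

lemma aic_tower (hc : Monotone c) (hc0 : c 0 = 0) (hl : Monotone l) (hl0 : 0 ≤ l 0) (M : ℝ)
    (n : ℕ) : AIC M (tower c l n) := by
  refine ⟨measurable_tower n, ?_, fun x' x _ hx _ => ?_⟩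
  · rw [tower_eq_tower_of_le hc (Nat.zero_le n)]
    · simp [tower]
    · intro i _
      have h1 := hl (Nat.zero_le i)
      have h2 := hc (Nat.zero_le i)
      linarith
  · obtain ⟨h1, h2⟩ := tower_sub_mem_Icc hc hc0 hl n hx
    constructor <;> linarith

end Tower

/-! ### The essential supremum and integrability -/

lemma ae_le_of_essSup_pos {μ : Measure Ω} {X : Ω → ℝ} {M : ℝ}
    (hM : essSup X μ = M) (hM0 : 0 < M) : ∀ᵐ ω ∂μ, X ω ≤ M := by
  by_cases hb : Filter.IsBoundedUnder (· ≤ ·) (ae μ) X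
  · rw [← hM]
    exact ae_le_essSup hb
  · exfalso
    have : essSup X μ = 0 := by
      rw [essSup, Filter.limsup_eq]
      have : {a : ℝ | ∀ᶠ n in ae μ, X n ≤ a} = ∅ := by
        ext a
        simp only [mem_ofPred_eq, mem_empty_iff_false, iff_false]
        exact fun h => hb ⟨a, h⟩
      rw [this, Real.sInf_empty]
    linarith

lemma integrable_of_ae_mem_Icc {μ : Measure Ω} [IsFiniteMeasure μ] {f : Ω → ℝ}
    (hf : Measurable f) {A B : ℝ} (h : ∀ᵐ ω ∂μ, f ω ∈ Icc A B) : Integrable f μ := by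
  refine Integrable.of_bound hf.aestronglyMeasurable (max |A| |B|) ?_
  filter_upwards [h] with ω hω
  exact abs_le_max_abs_abs hω.1 hω.2

lemma integrable_comp_of_ae_mem_Icc_s17 {μ : Measure Ω} [IsFiniteMeasure μ] {u : ℝ → ℝ}
    (hu : Continuous u) (hmono : Monotone u) {f : Ω → ℝ}
    (hf : Measurable f) {A B : ℝ} (h : ∀ᵐ ω ∂μ, f ω ∈ Icc A B) :
    Integrable (fun ω => u (f ω)) μ := by
  refine integrable_of_ae_mem_Icc (A := u A) (B := u B) (hu.measurable.comp hf) ?_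
  filter_upwards [h] with ω hω
  exact ⟨hmono hω.1, hmono hω.2⟩

lemma continuous_integral_of_abs_sub_le {μ : Measure Ω} [IsProbabilityMeasure μ]
    {F : ℝ → Ω → ℝ} (hint : ∀ a, Integrable (F a) μ)
    (hlip : ∀ a b ω, |F a ω - F b ω| ≤ |a - b|) : Continuous (fun a => ∫ ω, F a ω ∂μ) := by
  refine (LipschitzWith.of_dist_le_mul (K := 1) fun a b => ?_).continuous
  rw [Real.dist_eq, Real.dist_eq, ← integral_sub (hint a) (hint b), NNReal.coe_one, one_mul]
  refine (abs_integral_le_integral_abs).trans ?_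
  calc ∫ ω, |F a ω - F b ω| ∂μ ≤ ∫ _, |a - b| ∂μ :=
        integral_mono ((hint a).sub (hint b)).abs (integrable_const _) (hlip a b)
    _ = |a - b| := by simp

section Market

variable {ℙ : Measure Ω} {X S : Ω → ℝ} {M η τ w : ℝ} {u : ℝ → ℝ}

lemma AIC.integrable [IsProbabilityMeasure ℙ] (hXm : Measurable X) (hX0 : ∀ ω, 0 ≤ X ω) (hXM : ∀ᵐ ω ∂ℙ, X ω ≤ M)
    {I : ℝ → ℝ} (hI : AIC M I) : Integrable (fun ω => I (X ω)) ℙ := by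
  refine integrable_of_ae_mem_Icc (A := 0) (B := M) (hI.1.comp hXm) ?_
  filter_upwards [hXM] with ω hω
  exact ⟨hI.nonneg (hX0 ω) hω, (hI.le_self (hX0 ω) hω).trans hω⟩

lemma AIC.piS_nonneg (hη : 0 ≤ η) (hX0 : ∀ ω, 0 ≤ X ω) (hXM : ∀ᵐ ω ∂ℙ, X ω ≤ M)
    {I : ℝ → ℝ} (hI : AIC M I) : 0 ≤ piS ℙ η X I := by
  refine mul_nonneg (by linarith) (integral_nonneg_of_ae ?_)
  filter_upwards [hXM] with ω hω
  exact hI.nonneg (hX0 ω) hω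

lemma AIC.integrable_utility [IsProbabilityMeasure ℙ] (hXm : Measurable X) (hSm : Measurable S) (hX0 : ∀ ω, 0 ≤ X ω)
    (hXM : ∀ᵐ ω ∂ℙ, X ω ≤ M) (hτ : τ ∈ Icc (0 : ℝ) 1) (hu : Continuous u) (hmono : Monotone u)
    {I : ℝ → ℝ} (hI : AIC M I) :
    Integrable (fun ω => u (wealthS ℙ η τ w X S I ω)) ℙ := by
  have hIX : Measurable fun ω => I (X ω) := hI.1.comp hXm
  refine integrable_comp_of_ae_mem_Icc_s17 (A := w - M - piS ℙ η X I) (B := w - piS ℙ η X I)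
    hu hmono ?_ ?_
  · unfold wealthS
    refine ((measurable_const.sub hXm).add (Measurable.ite ?_ hIX ?_)).sub measurable_const
    · exact measurableSet_le hIX (by fun_prop)
    · fun_prop
  · filter_upwards [hXM] with ω hω
    rw [wealthS_eq]
    have h1 := payout_mem_Icc hτ (le_max_right (S ω + piS ℙ η X I) 0) (hI.nonneg (hX0 ω) hω)
    have h2 := hI.le_self (hX0 ω) hω
    exact ⟨by linarith [h1.1], by linarith [h1.2]⟩

/-- Every admissible contract is dominated by one that never exceeds the largest asset level. -/
lemma AIC.exists_dominating_capped [IsProbabilityMeasure ℙ] (hXm : Measurable X) (hSm : Measurable S)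
    (hX0 : ∀ ω, 0 ≤ X ω) (hXM : ∀ᵐ ω ∂ℙ, X ω ≤ M) (hη : 0 ≤ η) (hτ : τ ∈ Icc (0 : ℝ) 1)
    (hu : Continuous u) (hmono : Monotone u) {σ : ℝ} (hσ : ∀ᵐ ω ∂ℙ, S ω ≤ σ)
    {I : ℝ → ℝ} (hI : AIC M I) :
    ∃ J : ℝ → ℝ, AIC M J ∧ (∀ x, J x ≤ max (σ + piS ℙ η X J) 0) ∧
      EUS ℙ η τ w X S u I ≤ EUS ℙ η τ w X S u J := by
  set p := piS ℙ η X I with hp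
  have hp0 : 0 ≤ p := hI.piS_nonneg hη hX0 hXM
  set C := max (σ + p) 0 with hC
  set K : ℝ → ℝ → ℝ := fun a x => max (min (I x) C - (p - a)) 0 with hK
  have hKint : ∀ a, Integrable (fun ω => K a (X ω)) ℙ := by
    intro a
    refine integrable_of_ae_mem_Icc (A := 0) (B := max (C - (p - a)) 0)
      (Measurable.comp (g := K a)
        (((hI.1.min measurable_const).sub_const _).max measurable_const) hXm) ?_
    refine Filter.Eventually.of_forall fun ω => ⟨le_max_right _ _, ?_⟩
    exact max_le_max (by linarith [min_le_right (I (X ω)) C]) le_rfl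
  have hcont : Continuous fun a => (1 + η) * ∫ ω, K a (X ω) ∂ℙ - a := by
    refine (continuous_const.mul (continuous_integral_of_abs_sub_le hKint ?_)).sub continuous_id
    intro a b ω
    refine (abs_max_sub_max_le_abs _ _ _).trans (le_of_eq ?_)
    congr 1
    ring
  obtain ⟨a, ⟨ha0, hap⟩, ha⟩ : ∃ a ∈ Icc 0 p, (1 + η) * ∫ ω, K a (X ω) ∂ℙ - a = 0 := by
    refine intermediate_value_Icc' hp0 hcont.continuousOn ⟨?_, ?_⟩
    · have : ∫ ω, K p (X ω) ∂ℙ ≤ ∫ ω, I (X ω) ∂ℙ := by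
        refine integral_mono_ae (hKint p) (hI.integrable hXm hX0 hXM) ?_
        filter_upwards [hXM] with ω hω
        exact max_le (by linarith [min_le_left (I (X ω)) C]) (hI.nonneg (hX0 ω) hω)
      have h2 : (1 + η) * ∫ ω, K p (X ω) ∂ℙ ≤ p := by
        rw [hp, piS]
        exact mul_le_mul_of_nonneg_left this (by linarith)
      linarith
    · rw [sub_zero]
      exact mul_nonneg (by linarith) (integral_nonneg fun ω => le_max_right _ _)
  have hKpi : piS ℙ η X (K a) = a := by
    rw [piS]
    linarith
  have hKA : AIC M (K a) := hI.capShift (le_max_right _ _) (by linarith)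
  refine ⟨K a, hKA, ?_, ?_⟩
  · intro x
    rw [hKpi]
    refine max_le ?_ (le_max_right _ _)
    rcases le_total (σ + p) 0 with h | h
    · have h1 : C = 0 := max_eq_right h
      have h2 := min_le_right (I x) C
      exact le_trans (by linarith) (le_max_right _ _)
    · have h1 : C = σ + p := max_eq_left h
      have h2 := min_le_right (I x) C
      exact le_trans (by linarith) (le_max_left _ _)
  · refine integral_mono_ae (hI.integrable_utility hXm hSm hX0 hXM hτ hu hmono)
      (hKA.integrable_utility hXm hSm hX0 hXM hτ hu hmono) ?_
    filter_upwards [hXM, hσ] with ω hω hSω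
    refine hmono ?_
    rw [wealthS_eq, wealthS_eq, hKpi, ← hp]
    have := payout_sub_le_payout_shift hτ hSω hap (y := I (X ω))
    simp only [hK]
    linarith

end Market

/-! ### Layering a capped contract -/

/-- A slope bound for a function with antitone derivative, when `K` lies beyond `y` as seen
from `x`. -/
lemma mul_sub_le_sub_of_antitone_deriv {u u' : ℝ → ℝ} (hu : ∀ x, HasDerivAt u (u' x) x)
    (hanti : Antitone u') {x y K : ℝ} (h1 : x < y → y ≤ K) (h2 : y < x → K ≤ y) :
    u' K * (y - x) ≤ u y - u x := by
  have hcont : Continuous u := continuous_iff_continuousAt.2 fun z => (hu z).continuousAt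
  rcases lt_trichotomy x y with h | h | h
  · obtain ⟨z, hz, hzu⟩ := exists_hasDerivAt_eq_slope u u' h hcont.continuousOn fun t _ => hu t
    rw [eq_div_iff (by linarith)] at hzu
    rw [← hzu]
    exact mul_le_mul_of_nonneg_right (hanti (hz.2.le.trans (h1 h))) (by linarith)
  · simp [h]
  · obtain ⟨z, hz, hzu⟩ := exists_hasDerivAt_eq_slope u u' h hcont.continuousOn fun t _ => hu t
    rw [eq_div_iff (by linarith)] at hzu
    have := mul_le_mul_of_nonneg_right (hanti ((h2 h).trans hz.1.le)) (by linarith : 0 ≤ x - y)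
    linarith

/-- The excess over `J` of the layer with deductible `l`, on the region where
`c i < J ≤ c (i + 1)`. -/
def layerGap (c : ℕ → ℝ) (J : ℝ → ℝ) (i : ℕ) (l x : ℝ) : ℝ :=
  if c i < J x ∧ J x ≤ c (i + 1) then max (c i) (min (x - l) (c (i + 1))) - J x else 0

lemma layerGap_of_mem {c : ℕ → ℝ} {J : ℝ → ℝ} {i : ℕ} {l x : ℝ}
    (h : c i < J x ∧ J x ≤ c (i + 1)) :
    layerGap c J i l x = max (c i) (min (x - l) (c (i + 1))) - J x := if_pos h

lemma measurable_layerGap {c : ℕ → ℝ} {J : ℝ → ℝ} (hJ : Measurable J) (i : ℕ) (l : ℝ) :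
    Measurable (layerGap c J i l) := by
  unfold layerGap
  refine Measurable.ite ?_ (by fun_prop) measurable_const
  exact (measurableSet_lt measurable_const hJ).inter (measurableSet_le hJ measurable_const)

lemma integrable_layerGap {ℙ : Measure Ω} [IsFiniteMeasure ℙ] {X : Ω → ℝ} (hXm : Measurable X)
    {c : ℕ → ℝ} (hc : Monotone c) {J : ℝ → ℝ} (hJ : Measurable J) (i : ℕ) (l : ℝ) :
    Integrable (fun ω => layerGap c J i l (X ω)) ℙ := by
  have h2 : c i ≤ c (i + 1) := hc (Nat.le_succ i)
  refine integrable_of_ae_mem_Icc (A := -(c (i + 1) - c i)) (B := c (i + 1) - c i)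
    ((measurable_layerGap hJ i l).comp hXm) (Filter.Eventually.of_forall fun ω => ?_)
  unfold layerGap
  split_ifs with h
  · have h3 := le_max_left (c i) (min (X ω - l) (c (i + 1)))
    have h4 : max (c i) (min (X ω - l) (c (i + 1))) ≤ c (i + 1) := max_le h2 (min_le_right _ _)
    exact ⟨by linarith [h.2], by linarith [h.1]⟩
  · exact ⟨by linarith, by linarith⟩

lemma abs_layerGap_sub_le (c : ℕ → ℝ) (J : ℝ → ℝ) (i : ℕ) (l l' x : ℝ) :
    |layerGap c J i l x - layerGap c J i l' x| ≤ |l - l'| := by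
  unfold layerGap
  split_ifs with h
  · rw [sub_sub_sub_cancel_right, max_comm (c i), max_comm (c i)]
    refine (abs_max_sub_max_le_abs _ _ _).trans ((abs_min_sub_min_le_max _ _ _ _).trans ?_)
    rw [sub_self, abs_zero, max_eq_left (abs_nonneg _), sub_sub_sub_cancel_left, abs_sub_comm]
  · simp

lemma exists_deductible {ℙ : Measure Ω} [IsProbabilityMeasure ℙ] {X : Ω → ℝ} {M : ℝ}
    (hXm : Measurable X) (hX0 : ∀ ω, 0 ≤ X ω) (hXM : ∀ᵐ ω ∂ℙ, X ω ≤ M)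
    {c d : ℕ → ℝ} (hc : Monotone c) {J : ℝ → ℝ} (hJ : Measurable J) (hd : Monotone d)
    (hle : ∀ i x, 0 ≤ x → x ≤ M → J x ≤ c i → x - J x ≤ d i)
    (hge : ∀ i x, 0 ≤ x → x ≤ M → c i < J x → d i ≤ x - J x) (i : ℕ) :
    ∃ l ∈ Icc (d i) (d (i + 1)), ∫ ω, layerGap c J i l (X ω) ∂ℙ = 0 := by
  refine intermediate_value_Icc' (hd (Nat.le_succ i))
    (continuous_integral_of_abs_sub_le (integrable_layerGap hXm hc hJ i)
      fun a b ω => abs_layerGap_sub_le c J i a b (X ω)).continuousOn ⟨?_, ?_⟩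
  · refine integral_nonpos_of_ae ?_
    filter_upwards [hXM] with ω hω
    unfold layerGap
    split_ifs with h
    · have h1 := hle (i + 1) (X ω) (hX0 ω) hω h.2
      have := max_le h.1.le ((min_le_left (X ω - d (i + 1)) (c (i + 1))).trans (by linarith))
      simp only [Pi.zero_apply]
      linarith
    · exact le_rfl
  · refine integral_nonneg_of_ae ?_
    filter_upwards [hXM] with ω hω
    unfold layerGap
    split_ifs with h
    · have h1 := hge i (X ω) (hX0 ω) hω h.1
      have : J (X ω) ≤ max (c i) (min (X ω - d i) (c (i + 1))) :=
        (le_min (by linarith) h.2).trans (le_max_right _ _)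
      simp only [Pi.zero_apply]
      linarith
    · exact le_rfl

lemma le_or_exists_mem_Ioc (c : ℕ → ℝ) {n : ℕ} {y : ℝ} (h : y ≤ c n) :
    y ≤ c 0 ∨ ∃ i < n, c i < y ∧ y ≤ c (i + 1) := by
  induction n with
  | zero => exact Or.inl h
  | succ n ih =>
    by_cases h1 : y ≤ c n
    · exact (ih h1).imp_right fun ⟨i, hi, h2⟩ => ⟨i, by omega, h2⟩
    · exact Or.inr ⟨n, by omega, not_le.1 h1, h⟩

lemma layerGap_eq_zero {c : ℕ → ℝ} (hc : Monotone c) {J : ℝ → ℝ} {i k : ℕ} {l x : ℝ}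
    (h : c i < J x ∧ J x ≤ c (i + 1)) (hk : k ≠ i) : layerGap c J k l x = 0 := by
  refine if_neg fun ⟨h1, h2⟩ => ?_
  rcases lt_or_gt_of_ne hk with h3 | h3
  · linarith [hc (Nat.succ_le_of_lt h3), h.1]
  · linarith [hc (Nat.succ_le_of_lt h3), h.2]

lemma layerGap_eq_zero_of_le {c : ℕ → ℝ} (hc : Monotone c) {J : ℝ → ℝ} {k : ℕ} {l x : ℝ}
    (h : J x ≤ c 0) : layerGap c J k l x = 0 :=
  if_neg fun ⟨h1, _⟩ => by linarith [hc (Nat.zero_le k)]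

section Interlaced

variable {M : ℝ} {c d l : ℕ → ℝ} {J : ℝ → ℝ}

lemma tower_eq_zero_of_le (hc : Monotone c) (hd : Monotone d)
    (hle : ∀ i x, 0 ≤ x → x ≤ M → J x ≤ c i → x - J x ≤ d i)
    (hl : ∀ i, l i ∈ Icc (d i) (d (i + 1))) {n : ℕ} {x : ℝ} (h0 : 0 ≤ x) (hx : x ≤ M)
    (h : J x ≤ c 0) : tower c l n x = 0 := by
  rw [tower_eq_tower_of_le hc (Nat.zero_le n)]
  · simp [tower]
  · intro i _
    have h1 := hle 0 x h0 hx h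
    linarith [hc (Nat.zero_le i), hd (Nat.zero_le i), (hl i).1]

lemma tower_eq_of_lt (hc : Monotone c) (hc0 : c 0 = 0)
    (hge : ∀ i x, 0 ≤ x → x ≤ M → c i < J x → d i ≤ x - J x)
    (hl : ∀ i, l i ∈ Icc (d i) (d (i + 1))) {i : ℕ} {x : ℝ} (h0 : 0 ≤ x) (hx : x ≤ M)
    (h : c i < J x) : tower c l i x = c i := by
  refine tower_eq_of_le hc hc0 fun k hk => ?_
  have h1 := hc (Nat.succ_le_of_lt hk)
  simp only [Nat.succ_eq_add_one] at h1
  have h2 := hge (k + 1) x h0 hx (by linarith)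
  linarith [(hl k).2]

lemma tower_eq_of_mem (hc : Monotone c) (hc0 : c 0 = 0) (hd : Monotone d)
    (hle : ∀ i x, 0 ≤ x → x ≤ M → J x ≤ c i → x - J x ≤ d i)
    (hge : ∀ i x, 0 ≤ x → x ≤ M → c i < J x → d i ≤ x - J x)
    (hl : ∀ i, l i ∈ Icc (d i) (d (i + 1))) {i n : ℕ} (hin : i < n) {x : ℝ} (h0 : 0 ≤ x)
    (hx : x ≤ M) (h : c i < J x ∧ J x ≤ c (i + 1)) :
    tower c l n x = max (c i) (min (x - l i) (c (i + 1))) := by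
  have h2 : c i ≤ c (i + 1) := hc (Nat.le_succ i)
  rw [tower_eq_tower_of_le hc (Nat.succ_le_of_lt hin), Nat.succ_eq_add_one, tower_succ,
    tower_eq_of_lt hc hc0 hge hl h0 hx h.1]
  · rcases le_total (x - l i) (c i) with h3 | h3
    · rw [min_eq_left (h3.trans h2), max_eq_left h3, max_eq_right (by linarith),
        max_eq_right (by linarith)]
      ring
    · rw [max_eq_right (le_min h3 h2), max_eq_left (by linarith)]
      rcases le_total (x - l i) (c (i + 1)) with h4 | h4
      · rw [min_eq_left h4, max_eq_right (by linarith)]; ring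
      · rw [min_eq_right h4, max_eq_left (by linarith)]; ring
  · intro k hk
    have h1 := hle (i + 1) x h0 hx h.2
    linarith [hc hk, hd hk, (hl k).1, h.2]

lemma tower_sub_eq_sum_layerGap (hc : Monotone c) (hc0 : c 0 = 0) (hd : Monotone d)
    (hle : ∀ i x, 0 ≤ x → x ≤ M → J x ≤ c i → x - J x ≤ d i)
    (hge : ∀ i x, 0 ≤ x → x ≤ M → c i < J x → d i ≤ x - J x)
    (hl : ∀ i, l i ∈ Icc (d i) (d (i + 1))) (hJ : AIC M J) {n : ℕ} {x : ℝ} (h0 : 0 ≤ x)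
    (hx : x ≤ M) (hJn : J x ≤ c n) :
    tower c l n x - J x = ∑ i ∈ Finset.range n, layerGap c J i (l i) x := by
  rcases le_or_exists_mem_Ioc c hJn with h | ⟨i, hi, h⟩
  · rw [tower_eq_zero_of_le hc hd hle hl h0 hx h,
      Finset.sum_eq_zero fun k _ => layerGap_eq_zero_of_le hc h]
    linarith [hJ.nonneg h0 hx]
  · rw [Finset.sum_eq_single_of_mem i (Finset.mem_range.2 hi)
      fun k _ hk => layerGap_eq_zero hc h hk, layerGap_of_mem h,
      tower_eq_of_mem hc hc0 hd hle hge hl hi h0 hx h]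

/-- The utility gain of the tower over `J` in state `j`, in terms of the layer gaps. -/
lemma sum_layerGap_le_utility_sub (hc : Monotone c) (hc0 : c 0 = 0) (hd : Monotone d)
    (hle : ∀ i x, 0 ≤ x → x ≤ M → J x ≤ c i → x - J x ≤ d i)
    (hge : ∀ i x, 0 ≤ x → x ≤ M → c i < J x → d i ≤ x - J x)
    (hl : ∀ i, l i ∈ Icc (d i) (d (i + 1))) (hJ : AIC M J) {u u' : ℝ → ℝ}
    (hu : ∀ x, HasDerivAt u (u' x) x) (hanti : Antitone u') (hmono : Monotone u)
    {τ : ℝ} (hτ : τ ∈ Icc (0 : ℝ) 1) (w p : ℝ) {n j : ℕ} {x : ℝ} (h0 : 0 ≤ x)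
    (hx : x ≤ M) (hJn : J x ≤ c n) :
    ∑ i ∈ Finset.range n,
        u' (w - l i - p) * ((if i + 1 ≤ j then 1 else 0) * layerGap c J i (l i) x) ≤
      u (w - x + payout τ (c j) (tower c l n x) - p) - u (w - x + payout τ (c j) (J x) - p) := by
  have hcj : 0 ≤ c j := hc0 ▸ hc (Nat.zero_le j)
  rcases le_or_exists_mem_Ioc c hJn with h | ⟨i, hi, h⟩
  · rw [Finset.sum_eq_zero fun k _ => by rw [layerGap_eq_zero_of_le hc h, mul_zero, mul_zero],
      tower_eq_zero_of_le hc hd hle hl h0 hx h,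
      (by linarith [hJ.nonneg h0 hx] : J x = 0), sub_self]
  · rw [Finset.sum_eq_single_of_mem i (Finset.mem_range.2 hi)
      fun k _ hk => by rw [layerGap_eq_zero hc h hk, mul_zero, mul_zero]]
    have hT := tower_eq_of_mem hc hc0 hd hle hge hl hi h0 hx h
    have h2 : c i ≤ c (i + 1) := hc (Nat.le_succ i)
    split_ifs with hij
    · have h3 : c (i + 1) ≤ c j := hc hij
      have h4 : max (c i) (min (x - l i) (c (i + 1))) ≤ c (i + 1) := max_le h2 (min_le_right _ _)
      rw [layerGap_of_mem h, hT, payout, if_pos (h4.trans h3), payout, if_pos (h.2.trans h3)]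
      set T := max (c i) (min (x - l i) (c (i + 1))) with hTdef
      have key := mul_sub_le_sub_of_antitone_deriv hu hanti (x := w - x + J x - p)
        (y := w - x + T - p) (K := w - l i - p) ?_ ?_
      · convert key using 2
        ring
      · intro h5
        have h6 : T = min (x - l i) (c (i + 1)) := by
          rcases max_choice (c i) (min (x - l i) (c (i + 1))) with h7 | h7
          · linarith [h.1]
          · exact h7
        linarith [min_le_left (x - l i) (c (i + 1))]
      · intro h5
        have h6 : min (x - l i) (c (i + 1)) ≤ T := le_max_right _ _
        rcases min_le_iff.1 h6 with h7 | h7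
        · linarith
        · linarith [h.2]
    · have h3 : c j ≤ c i := hc (by omega)
      have h4 : c j ≤ tower c l n x := by
        rw [hT]
        exact h3.trans (le_max_left _ _)
      rw [zero_mul, mul_zero, sub_nonneg]
      refine hmono ?_
      have := mul_le_payout hτ hcj h4
      rw [payout.eq_1 τ (c j) (J x), if_neg (by linarith [h.1])]
      linarith

end Interlaced

/-- A contract that never exceeds the largest asset level is dominated by a tower of layers with
the same premium. -/
lemma AIC.exists_dominating_tower {ℙ : Measure Ω} [IsProbabilityMeasure ℙ] {X S : Ω → ℝ}
    {M η τ w : ℝ} (hXm : Measurable X) (hSm : Measurable S) (hM0 : 0 ≤ M)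
    (hX0 : ∀ ω, 0 ≤ X ω) (hXM : ∀ᵐ ω ∂ℙ, X ω ≤ M) (hτ : τ ∈ Icc (0 : ℝ) 1)
    {u u' : ℝ → ℝ} (hu : ∀ x, HasDerivAt u (u' x) x) (hanti : Antitone u') (hmono : Monotone u)
    {N : ℕ} {s : ℕ → ℝ} (hs : StrictMonoOn s (Icc 1 N))
    (hrange : ∀ᵐ ω ∂ℙ, ∃ i ∈ Icc 1 N, S ω = s i) (hindep : ProbabilityTheory.IndepFun X S ℙ)
    {J : ℝ → ℝ} (hJ : AIC M J) {c : ℕ → ℝ} (hc : Monotone c) (hc0 : c 0 = 0)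
    (hcs : ∀ i ∈ Icc 1 N, c i = max (s i + piS ℙ η X J) 0) (hJN : ∀ x, J x ≤ c N) :
    ∃ l : ℕ → ℝ, Monotone l ∧ (∀ i, 0 ≤ l i ∧ l i ≤ M) ∧
      piS ℙ η X (tower c l N) = piS ℙ η X J ∧
      EUS ℙ η τ w X S u J ≤ EUS ℙ η τ w X S u (tower c l N) := by
  obtain ⟨d, hd, hd0, hle, hge⟩ := hJ.exists_separating hM0 hc hc0
  choose l hl hl0 using exists_deductible hXm hX0 hXM hc hJ.1 hd hle hge
  have hlmono : Monotone l := monotone_nat_of_le_succ fun i => (hl i).2.trans (hl (i + 1)).1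
  have hT : AIC M (tower c l N) :=
    aic_tower hc hc0 hlmono ((hd0 0).1.trans (hl 0).1) M N
  have hgap := fun i => integrable_layerGap (ℙ := ℙ) hXm hc hJ.1 i (l i)
  have hpi : piS ℙ η X (tower c l N) = piS ℙ η X J := by
    unfold piS
    congr 1
    rw [← sub_eq_zero, ← integral_sub (hT.integrable hXm hX0 hXM) (hJ.integrable hXm hX0 hXM)]
    have : ∀ᵐ ω ∂ℙ, tower c l N (X ω) - J (X ω) =
        ∑ i ∈ Finset.range N, layerGap c J i (l i) (X ω) := by
      filter_upwards [hXM] with ω hω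
      exact tower_sub_eq_sum_layerGap hc hc0 hd hle hge hl hJ (hX0 ω) hω (hJN _)
    rw [integral_congr_ae this, integral_finsetSum _ fun i _ => hgap i]
    exact Finset.sum_eq_zero fun i _ => hl0 i
  refine ⟨l, hlmono, fun i => ⟨(hd0 i).1.trans (hl i).1, (hl i).2.trans (hd0 (i + 1)).2⟩, hpi, ?_⟩
  have hucont : Continuous u := continuous_iff_continuousAt.2 fun z => (hu z).continuousAt
  have hJi := hJ.integrable_utility (η := η) (w := w) hXm hSm hX0 hXM hτ hucont hmono
  have hTi := hT.integrable_utility (η := η) (w := w) hXm hSm hX0 hXM hτ hucont hmono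
  set p := piS ℙ η X J with hp
  have hind : ∀ i : ℕ, Measurable fun t : ℝ => if s (i + 1) ≤ t then (1 : ℝ) else 0 := fun i =>
    Measurable.ite measurableSet_Ici measurable_const measurable_const
  have hgi : ∀ i ∈ Finset.range N, Integrable (fun ω => u' (w - l i - p) *
      ((if s (i + 1) ≤ S ω then 1 else 0) * layerGap c J i (l i) (X ω))) ℙ := by
    intro i _
    refine ((hgap i).bdd_mul (c := 1) ((hind i).comp hSm).aestronglyMeasurable
      (Filter.Eventually.of_forall fun ω => ?_)).const_mul _
    simp only [Function.comp]
    split_ifs <;> simp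
  have hzero : ∫ ω, ∑ i ∈ Finset.range N, u' (w - l i - p) *
      ((if s (i + 1) ≤ S ω then 1 else 0) * layerGap c J i (l i) (X ω)) ∂ℙ = 0 := by
    rw [integral_finsetSum _ hgi]
    refine Finset.sum_eq_zero fun i _ => ?_
    have hi := hindep.symm.comp (hind i) (measurable_layerGap (c := c) hJ.1 i (l i))
    have hmul := hi.integral_fun_mul_eq_mul_integral ((hind i).comp hSm).aestronglyMeasurable
      ((measurable_layerGap (c := c) hJ.1 i (l i)).comp hXm).aestronglyMeasurable
    simp only [Function.comp] at hmul
    rw [integral_const_mul, hmul, hl0 i, mul_zero, mul_zero]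
  have hfinal : ∫ ω, ∑ i ∈ Finset.range N, u' (w - l i - p) *
      ((if s (i + 1) ≤ S ω then 1 else 0) * layerGap c J i (l i) (X ω)) ∂ℙ ≤
      ∫ ω, (u (wealthS ℙ η τ w X S (tower c l N) ω) - u (wealthS ℙ η τ w X S J ω)) ∂ℙ := by
    refine integral_mono_ae (integrable_finsetSum _ hgi) (hTi.sub hJi) ?_
    filter_upwards [hXM, hrange] with ω hω ⟨j, hj, hSj⟩
    have h1 := sum_layerGap_le_utility_sub hc hc0 hd hle hge hl hJ hu hanti hmono hτ w p (j := j)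
      (hX0 ω) hω (hJN _)
    rw [wealthS_eq, wealthS_eq, hpi, ← hp, hSj, ← hcs j hj]
    refine (Finset.sum_congr rfl fun i hi => ?_).trans_le h1
    have h2 : s (i + 1) ≤ s j ↔ i + 1 ≤ j :=
      hs.le_iff_le ⟨by omega, Finset.mem_range.1 hi⟩ hj
    simp only [h2]
  rw [hzero, integral_sub hTi hJi] at hfinal
  unfold EUS
  linarith

/-! ### The bound on the premium -/

/-- A premium at which the fully capped contract is at least self-financing lies below the zero
of `gN`. -/
lemma le_of_gN_nonneg {ℙ : Measure Ω} [IsProbabilityMeasure ℙ] {X : Ω → ℝ} {M η σ a b : ℝ}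
    (hXm : Measurable X) (hX0 : ∀ ω, 0 ≤ X ω) (hM : essSup X ℙ = M) (hM0 : 0 < M)
    (hη : 0 ≤ η) (hσ : 0 < σ) (hb : 0 ≤ b) (hgb : gN ℙ η X σ b = 0) (hga : 0 ≤ gN ℙ η X σ a) :
    a ≤ b := by
  by_contra! hba
  have hXM := ae_le_of_essSup_pos hM hM0
  have hint : ∀ t, 0 ≤ t → Integrable (fun ω => X ω - max (X ω - (σ + t)) 0) ℙ := by
    intro t ht
    refine integrable_of_ae_mem_Icc (A := 0) (B := M) (by fun_prop) ?_
    filter_upwards [hXM] with ω hω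
    have h1 : max (X ω - (σ + t)) 0 ≤ X ω := max_le (by linarith) (hX0 ω)
    exact ⟨by linarith, by linarith [le_max_right (X ω - (σ + t)) 0]⟩
  have hconc : (a - b) * ∫ ω, (X ω - max (X ω - (σ + 0)) 0) ∂ℙ +
      b * ∫ ω, (X ω - max (X ω - (σ + a)) 0) ∂ℙ ≤
      a * ∫ ω, (X ω - max (X ω - (σ + b)) 0) ∂ℙ := by
    rw [← integral_const_mul, ← integral_const_mul, ← integral_const_mul,
      ← integral_add ((hint 0 le_rfl).const_mul _) ((hint a (by linarith)).const_mul _)]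
    refine integral_mono (((hint 0 le_rfl).const_mul _).add ((hint a (by linarith)).const_mul _))
      ((hint b hb).const_mul _) fun ω => ?_
    have ha0 : X ω - max (X ω - (σ + a)) 0 ≤ X ω := by linarith [le_max_right (X ω - (σ + a)) 0]
    have ha1 : X ω - max (X ω - (σ + a)) 0 ≤ σ + a := by linarith [le_max_left (X ω - (σ + a)) 0]
    have h00 : X ω - max (X ω - (σ + 0)) 0 ≤ X ω := by linarith [le_max_right (X ω - (σ + 0)) 0]
    have h01 : X ω - max (X ω - (σ + 0)) 0 ≤ σ := by linarith [le_max_left (X ω - (σ + 0)) 0]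
    show (a - b) * (X ω - max (X ω - (σ + 0)) 0) + b * (X ω - max (X ω - (σ + a)) 0) ≤
      a * (X ω - max (X ω - (σ + b)) 0)
    rcases max_cases (X ω - (σ + b)) 0 with ⟨h, _⟩ | ⟨h, _⟩ <;> rw [h] <;> nlinarith
  have hpos : 0 < ∫ ω, (X ω - max (X ω - (σ + 0)) 0) ∂ℙ := by
    have hnn : 0 ≤ fun ω => X ω - max (X ω - (σ + 0)) 0 := fun ω =>
      sub_nonneg.2 (max_le (by linarith) (hX0 ω))
    refine lt_of_le_of_ne (integral_nonneg hnn) fun h => ?_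
    have h1 := (integral_eq_zero_iff_of_nonneg hnn (hint 0 le_rfl)).1 h.symm
    have h2 : X =ᵐ[ℙ] fun _ => (0 : ℝ) := by
      filter_upwards [h1] with ω hω
      simp only [Pi.zero_apply] at hω
      rcases max_cases (X ω - (σ + 0)) 0 with ⟨h, _⟩ | ⟨h, _⟩ <;> linarith
    rw [essSup_congr_ae h2, essSup_const _ (IsProbabilityMeasure.ne_zero ℙ)] at hM
    linarith
  unfold gN at hgb hga
  set A := ∫ ω, (X ω - max (X ω - (σ + 0)) 0) ∂ℙ
  have h1 : 0 < (a - b) * A := mul_pos (by linarith) hpos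
  nlinarith [mul_le_mul_of_nonneg_left hconc (by linarith : 0 ≤ 1 + η), mul_nonneg hb hga,
    mul_nonneg hη h1.le]

/-- for every `I ∈ 𝓐_IC` there exist `a` and `0 ≤ l₁ ≤ ⋯ ≤ l_N ≤ M` such
that the multi-layer contract `Î` is in `𝓐_IC`, has premium `a`, and dominates `I` in
expected utility; moreover if `s_N > 0` then `a ∈ [0, ā_N]`. -/
theorem stmt17
    (ℙ : Measure Ω) [IsProbabilityMeasure ℙ]
    (X S : Ω → ℝ) (hXm : Measurable X) (hSm : Measurable S)
    (hX0 : ∀ ω, 0 ≤ X ω) (M : ℝ) (hM : essSup X ℙ = M) (hM0 : 0 < M)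
    (η : ℝ) (hη : 0 ≤ η) (τ : ℝ) (hτ : τ ∈ Icc (0 : ℝ) 1) (w : ℝ)
    (u u' u'' : ℝ → ℝ)
    (hu' : ∀ x, HasDerivAt u (u' x) x) (hu'' : ∀ x, HasDerivAt u' (u'' x) x)
    (hu'pos : ∀ x, 0 < u' x) (hu''neg : ∀ x, u'' x < 0)
    (N : ℕ) (hN : 1 ≤ N) (s : ℕ → ℝ)
    (hs : StrictMonoOn s (Icc 1 N))
    (hsp : ∀ i ∈ Icc 1 N, 0 < ℙ {ω | S ω = s i})
    (hrange : ∀ᵐ ω ∂ℙ, ∃ i ∈ Icc 1 N, S ω = s i)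
    (hindep : ProbabilityTheory.IndepFun X S ℙ) :
    ∀ I : ℝ → ℝ, AIC M I →
      ∃ a : ℝ, ∃ l : ℕ → ℝ,
        (∀ i ∈ Icc 1 N, 0 ≤ l i ∧ l i ≤ M) ∧
        MonotoneOn l (Icc 1 N) ∧
        AIC M (layered N a s l) ∧
        piS ℙ η X (layered N a s l) = a ∧
        EUS ℙ η τ w X S u I ≤ EUS ℙ η τ w X S u (layered N a s l) ∧
        (0 < s N →
          ∀ aN ∈ Icc (0 : ℝ) (piFull ℙ η X),
            gN ℙ η X (s N) aN = 0 → a ∈ Icc 0 aN) := by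
  intro I hI
  have hXM := ae_le_of_essSup_pos hM hM0
  have hucont : Continuous u := continuous_iff_continuousAt.2 fun z => (hu' z).continuousAt
  have hmono : Monotone u := (strictMono_of_hasDerivAt_pos hu' hu'pos).monotone
  have hanti : Antitone u' := (strictAnti_of_hasDerivAt_neg hu'' hu''neg).antitone
  have hsN : ∀ᵐ ω ∂ℙ, S ω ≤ s N := by
    filter_upwards [hrange] with ω ⟨i, hi, h⟩
    exact h ▸ hs.monotoneOn hi ⟨hN, le_rfl⟩ hi.2
  obtain ⟨J, hJ, hJcap, hIJ⟩ := hI.exists_dominating_capped (η := η) (τ := τ) (w := w)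
    hXm hSm hX0 hXM hη hτ hucont hmono hsN
  set a := piS ℙ η X J with ha
  have ha0 : 0 ≤ a := hJ.piS_nonneg hη hX0 hXM
  set c : ℕ → ℝ := fun i => if i = 0 then 0 else max (s (min i N) + a) 0 with hcdef
  have hc0 : c 0 = 0 := rfl
  have hcs : ∀ i ∈ Icc 1 N, c i = max (s i + a) 0 := fun i hi => by
    simp only [hcdef, if_neg (by have := hi.1; omega : i ≠ 0), min_eq_left hi.2]
  have hc : Monotone c := by
    refine monotone_nat_of_le_succ fun i => ?_
    rcases Nat.eq_zero_or_pos i with rfl | hi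
    · simp [hcdef]
    · simp only [hcdef, if_neg hi.ne', if_neg (Nat.succ_ne_zero i)]
      refine max_le_max (add_le_add_left (hs.monotoneOn ?_ ?_ ?_) a) le_rfl
      · exact ⟨le_min hi hN, min_le_right _ _⟩
      · exact ⟨le_min (by omega) hN, min_le_right _ _⟩
      · exact min_le_min (Nat.le_succ i) le_rfl
  have hcN : c N = max (s N + a) 0 := hcs N ⟨hN, le_rfl⟩
  obtain ⟨l, hl, hlM, hpi, hEU⟩ := hJ.exists_dominating_tower (η := η) (τ := τ) (w := w)
    hXm hSm hM0.le hX0 hXM hτ hu' hanti hmono hs hrange hindep hc hc0 hcs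
    fun x => hcN ▸ hJcap x
  have hlay : layered N a s (fun i => l (i - 1)) = tower c l N :=
    layered_eq_tower hN hc0 fun i h1 h2 => by rw [hcs i ⟨h1, h2⟩, add_comm]
  have hT : AIC M (tower c l N) := aic_tower hc hc0 hl (hlM 0).1 M N
  refine ⟨a, fun i => l (i - 1), fun i _ => hlM _, fun i _ j _ hij => hl (by omega), ?_⟩
  rw [hlay]
  refine ⟨hT, hpi, hIJ.trans hEU, fun hsNpos aN haN hg => ⟨ha0, ?_⟩⟩
  refine le_of_gN_nonneg hXm hX0 hM hM0 hη hsNpos haN.1 hg (sub_nonneg.2 ?_)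
  rw [← hpi.trans ha.symm, piS]
  refine mul_le_mul_of_nonneg_left ?_ (by linarith)
  rw [← piS, hpi, ← ha]
  refine integral_mono_ae (hT.integrable hXm hX0 hXM) ?_ ?_
  · refine integrable_of_ae_mem_Icc (A := 0) (B := M) (by fun_prop) ?_
    filter_upwards [hXM] with ω hω
    have h1 : max (X ω - (s N + a)) 0 ≤ X ω := max_le (by linarith) (hX0 ω)
    exact ⟨by linarith, by linarith [le_max_right (X ω - (s N + a)) 0]⟩
  · filter_upwards [hXM] with ω hω
    have h1 := hT.le_self (hX0 ω) hω
    have h2 := tower_le (l := l) hc hc0 N (X ω)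
    rw [hcN, max_eq_left (by linarith)] at h2
    rcases max_cases (X ω - (s N + a)) 0 with ⟨h, _⟩ | ⟨h, _⟩ <;> rw [h] <;> linarith
end
end
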